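/- arXiv:2012.07129 — 2 statements merged into one kernel-verified Lean document; each statement's English description precedes it below -/
import Mathlib

section
/- Let R and B be disjoint locally finite subsets of ℝ, and let M be a perfect 2-colour matching of R and B in which no two edges are entwined. Then every point lies in the same level as its partner: for every edge ⟨r,b⟩ ∈ M there is a k ∈ ℤ with r, b ∈ Λ_k. Equivalently, for every edge ⟨r,b⟩ ∈ M, the open interval with endpoints r and b contains equally many points of R and of B. -/
/-- `M` is a 2-colour (partial) matching of `R` and `B`. -/
def IsMatch2 (R B : Set ℝ) (M : Set (ℝ × ℝ)) : Prop :=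
  (∀ e ∈ M, e.1 ∈ R ∧ e.2 ∈ B) ∧
  (∀ x y y' : ℝ, (x, y) ∈ M → (x, y') ∈ M → y = y') ∧
  (∀ x x' y : ℝ, (x, y) ∈ M → (x', y) ∈ M → x = x')

/-- `M` is a perfect 2-colour matching of `R` and `B`. -/
def Perfect2 (R B : Set ℝ) (M : Set (ℝ × ℝ)) : Prop :=
  (∀ r ∈ R, ∃ b, (r, b) ∈ M) ∧ (∀ b ∈ B, ∃ r, (r, b) ∈ M)

/-- `x` lies strictly between `a` and `b`. -/
def btw (a b x : ℝ) : Prop := min a b < x ∧ x < max a b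

/-- The four reals are pairwise distinct. -/
def distinct4 (a b c d : ℝ) : Prop :=
  a ≠ b ∧ a ≠ c ∧ a ≠ d ∧ b ≠ c ∧ b ≠ d ∧ c ≠ d

/-- The edges `{a,b}` and `{c,d}` are entwined. -/
def EntwinedP (a b c d : ℝ) : Prop :=
  distinct4 a b c d ∧ Xor' (btw a b c) (btw a b d)

/-- The edge `{a,b}` straddles the edge `{c,d}`. -/
def StraddleP (a b c d : ℝ) : Prop := btw a b c ∧ btw a b d

/-- In a perfect 2-colour matching of disjoint locally finite subsets of `ℝ` with no
two edges entwined, the open interval spanned by any edge contains equally many red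
and blue points (equivalently, each point lies in the same level as its partner). -/
theorem stmt_16 (R B : Set ℝ) (hRB : Disjoint R B)
    (hRloc : ∀ a b : ℝ, (R ∩ Set.Icc a b).Finite)
    (hBloc : ∀ a b : ℝ, (B ∩ Set.Icc a b).Finite)
    (M : Set (ℝ × ℝ)) (hM : IsMatch2 R B M) (hperf : Perfect2 R B M)
    (hent : ∀ e ∈ M, ∀ e' ∈ M, ¬ EntwinedP e.1 e.2 e'.1 e'.2) :
    ∀ e ∈ M, (R ∩ Set.Ioo (min e.1 e.2) (max e.1 e.2)).ncard
      = (B ∩ Set.Ioo (min e.1 e.2) (max e.1 e.2)).ncard := by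
  intro e he
  obtain ⟨hmem, hl, hr⟩ := hM
  have key : ∀ r b : ℝ, (r, b) ∈ M →
      (r ∈ Set.Ioo (min e.1 e.2) (max e.1 e.2) ↔ b ∈ Set.Ioo (min e.1 e.2) (max e.1 e.2)) := by
    intro r b h
    have h1 := hmem e he
    have h2 := hmem _ h
    have hne : ∀ x ∈ R, ∀ y ∈ B, x ≠ y := fun x hx y hy hxy =>
      Set.disjoint_left.mp hRB hx (hxy ▸ hy)
    have he' : (e.1, e.2) ∈ M := he
    by_cases hre : r = e.1
    · have hbe : b = e.2 := by
        subst hre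
        exact hl _ _ _ h he'
      subst hre hbe
      simp only [Set.mem_Ioo]
      rcases le_total e.1 e.2 with hh | hh <;> simp [hh]
    · have hbe : b ≠ e.2 := by
        rintro rfl
        exact hre (hr _ _ _ h he')
      have h3 := hent e he (r, b) h
      have hd : distinct4 e.1 e.2 r b :=
        ⟨hne _ h1.1 _ h1.2, Ne.symm hre, hne _ h1.1 _ h2.2, (hne _ h2.1 _ h1.2).symm,
          hbe.symm, hne _ h2.1 _ h2.2⟩
      have h4 : ¬ Xor' (btw e.1 e.2 r) (btw e.1 e.2 b) := fun hx => h3 ⟨hd, hx⟩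
      have h5 : btw e.1 e.2 r ↔ btw e.1 e.2 b := by
        unfold Xor' Xor at h4
        tauto
      exact h5
  have hex := hperf.1
  choose f hf using hex
  refine Set.ncard_congr (fun r hrr => f r hrr.1) ?_ ?_ ?_
  · intro r hrr
    exact ⟨(hmem _ (hf r hrr.1)).2, (key _ _ (hf r hrr.1)).1 hrr.2⟩
  · intro r r' h h' heq
    refine hr _ _ _ (hf r h.1) ?_
    have := hf r' h'.1
    have heq' : f r h.1 = f r' h'.1 := heq
    rw [heq']
    exact this
  · intro b hb
    obtain ⟨r, hrb⟩ := hperf.2 b hb.1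
    have hrR := (hmem _ hrb).1
    exact ⟨r, ⟨hrR, (key _ _ hrb).2 hb.2⟩, hl _ _ _ (hf r hrR) hrb⟩
end

section
/- Let R and B be disjoint finite subsets of ℝ of equal cardinality. Then there is exactly one perfect 2-colour matching M of R and B with the following two properties: no two edges of M are entwined, and no two edges of M of opposite orientations straddle one another. -/
/-- The conjunction of the properties of the matching in the statement. -/
def ValidM (R B : Set ℝ) (M : Set (ℝ × ℝ)) : Prop :=
  IsMatch2 R B M ∧ Perfect2 R B M ∧
      (∀ e ∈ M, ∀ e' ∈ M, ¬ EntwinedP e.1 e.2 e'.1 e'.2) ∧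
      (∀ e ∈ M, ∀ e' ∈ M,
        ((e.1 < e.2 ∧ e'.2 < e'.1) ∨ (e.2 < e.1 ∧ e'.1 < e'.2)) →
        ¬ StraddleP e.1 e.2 e'.1 e'.2)

theorem btw_comm' (a b x : ℝ) : btw a b x ↔ btw b a x := by
  unfold _root_.btw; rw [min_comm, max_comm]

theorem btw_of_lt {a b x : ℝ} (h : a < b) : btw a b x ↔ a < x ∧ x < b := by
  unfold _root_.btw; rw [min_eq_left h.le, max_eq_right h.le]

theorem btw_of_gt {a b x : ℝ} (h : b < a) : btw a b x ↔ b < x ∧ x < a := by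
  rw [btw_comm', btw_of_lt h]

theorem ValidM.swap {R B : Set ℝ} {M : Set (ℝ × ℝ)} (h : ValidM R B M) :
    ValidM B R (Prod.swap ⁻¹' M) := by
  obtain ⟨⟨h1, h2, h3⟩, ⟨h4, h5⟩, h6, h7⟩ := h
  refine ⟨⟨fun e he => ⟨(h1 _ he).2, (h1 _ he).1⟩, fun x y y' a b => h3 _ _ _ a b,
    fun x y y' a b => h2 _ _ _ a b⟩, ⟨h5, h4⟩, ?_, ?_⟩
  · rintro e he e' he' ⟨⟨a1, a2, a3, a4, a5, a6⟩, hx⟩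
    refine h6 _ he _ he' ⟨⟨a1.symm, a5, a4, a3, a2, a6.symm⟩, ?_⟩
    simp only [Prod.fst_swap, Prod.snd_swap]
    rw [btw_comm', btw_comm' e.2 e.1 e'.1]
    exact hx.symm
  · rintro e he e' he' ho ⟨s1, s2⟩
    refine h7 _ he _ he' ?_ ⟨(btw_comm' _ _ _).1 s2, (btw_comm' _ _ _).1 s1⟩
    simp only [Prod.fst_swap, Prod.snd_swap]
    exact ho.symm

theorem key_mem {R B : Set ℝ} {M : Set (ℝ × ℝ)} {p q : ℝ} (h : ValidM R B M)
    (hRB : Disjoint R B)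
    (hp : p ∈ R) (hq : q ∈ B) (hpq : p < q) (hB : ∀ b ∈ B, q ≤ b)
    (hR : ∀ r ∈ R, r ≤ p ∨ q < r) : (p, q) ∈ M := by
  obtain ⟨⟨h1, h2, h3⟩, ⟨h4, h5⟩, h6, h7⟩ := h
  obtain ⟨b, hb⟩ := h4 p hp
  obtain ⟨r, hr⟩ := h5 q hq
  by_contra hn
  have hbq : b ≠ q := by rintro rfl; exact hn hb
  have hrp : r ≠ p := by rintro rfl; exact hn hr
  have hbB := (h1 _ hb).2
  have hrR := (h1 _ hr).1
  have hqb : q < b := lt_of_le_of_ne (hB b hbB) hbq.symm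
  have hrb : r ≠ b := fun e => hRB.le_bot ⟨hrR, by rw [e]; exact hbB⟩
  have hpb : p < b := hpq.trans hqb
  rcases hR r hrR with hlt | hgt
  · have hlt : r < p := lt_of_le_of_ne hlt hrp
    have hrq := hlt.trans hpq
    refine h6 _ hr _ hb ⟨⟨hrq.ne, hlt.ne, hrb, hpq.ne', hbq.symm, hpb.ne⟩, Or.inl ?_⟩
    simp only [btw_of_lt hrq]
    exact ⟨⟨hlt, hpq⟩, fun hh => absurd hh.2 (not_lt.2 hqb.le)⟩
  · rcases lt_or_gt_of_ne hrb with hlt | hbr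
    · refine h7 _ hb _ hr (Or.inl ⟨hpb, hgt⟩) ?_
      simp only [StraddleP, btw_of_lt hpb]
      exact ⟨⟨hpq.trans hgt, hlt⟩, hpq, hqb⟩
    · refine h6 _ hb _ hr ⟨⟨hpb.ne, hrp.symm, hpq.ne, hrb.symm, hbq, hgt.ne'⟩, Or.inr ?_⟩
      simp only [btw_of_lt hpb]
      exact ⟨⟨hpq, hqb⟩, fun hh => absurd hh.2 (not_lt.2 hbr.le)⟩

theorem ValidM.remove {R B : Set ℝ} {M : Set (ℝ × ℝ)} {p q : ℝ} (h : ValidM R B M)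
    (hM : (p, q) ∈ M) : ValidM (R \ {p}) (B \ {q}) (M \ {(p, q)}) := by
  obtain ⟨⟨h1, h2, h3⟩, ⟨h4, h5⟩, h6, h7⟩ := h
  refine ⟨⟨?_, fun x y y' a b => h2 _ _ _ a.1 b.1, fun x y y' a b => h3 _ _ _ a.1 b.1⟩,
    ⟨?_, ?_⟩, fun e he e' he' => h6 e he.1 e' he'.1, fun e he e' he' => h7 e he.1 e' he'.1⟩
  · rintro ⟨x, y⟩ ⟨he, hne⟩
    refine ⟨⟨(h1 _ he).1, ?_⟩, ⟨(h1 _ he).2, ?_⟩⟩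
    · rintro rfl
      exact hne (by rw [h2 _ _ _ he hM]; rfl)
    · rintro rfl
      exact hne (by rw [h3 _ _ _ he hM]; rfl)
  · rintro r ⟨hr, hne⟩
    obtain ⟨b, hb⟩ := h4 r hr
    exact ⟨b, hb, fun e => hne (congrArg Prod.fst e)⟩
  · rintro b ⟨hb, hne⟩
    obtain ⟨r, hr⟩ := h5 b hb
    exact ⟨r, hr, fun e => hne (congrArg Prod.snd e)⟩

theorem ValidM.add {R B : Set ℝ} {M : Set (ℝ × ℝ)} {p q : ℝ}
    (h : ValidM (R \ {p}) (B \ {q}) M)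
    (hp : p ∈ R) (hq : q ∈ B) (hpq : p < q) (hB : ∀ b ∈ B, q ≤ b)
    (hR : ∀ r ∈ R, r ≤ p ∨ q < r) : ValidM R B (insert (p, q) M) := by
  obtain ⟨⟨h1, h2, h3⟩, ⟨h4, h5⟩, h6, h7⟩ := h
  have H : ∀ x y, (x, y) ∈ M → (x < p ∨ q < x) ∧ q < y := by
    intro x y hxy
    obtain ⟨⟨hx, hx'⟩, hy, hy'⟩ := h1 _ hxy
    refine ⟨?_, lt_of_le_of_ne (hB _ hy) (fun e => hy' e.symm)⟩
    rcases hR _ hx with h | h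
    · exact Or.inl (lt_of_le_of_ne h hx')
    · exact Or.inr h
  refine ⟨⟨?_, ?_, ?_⟩, ⟨?_, ?_⟩, ?_, ?_⟩
  · rintro e (rfl | he)
    · exact ⟨hp, hq⟩
    · exact ⟨(h1 _ he).1.1, (h1 _ he).2.1⟩
  · rintro x y y' (e | he) (e' | he')
    · simp_all
    · simp only [Prod.mk.injEq] at e
      have := H _ _ he'
      grind
    · simp only [Prod.mk.injEq] at e'
      have := H _ _ he
      grind
    · exact h2 _ _ _ he he'
  · rintro x y y' (e | he) (e' | he')
    · simp_all
    · simp only [Prod.mk.injEq] at e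
      have := H _ _ he'
      grind
    · simp only [Prod.mk.injEq] at e'
      have := H _ _ he
      grind
    · exact h3 _ _ _ he he'
  · intro r hr
    by_cases e : r = p
    · exact ⟨q, Or.inl (by rw [e])⟩
    · obtain ⟨b, hb⟩ := h4 r ⟨hr, e⟩
      exact ⟨b, Or.inr hb⟩
  · intro r hr
    by_cases e : r = q
    · exact ⟨p, Or.inl (by rw [e])⟩
    · obtain ⟨b, hb⟩ := h5 r ⟨hr, e⟩
      exact ⟨b, Or.inr hb⟩
  · rintro e (rfl | he) e' (rfl | he')
    · rintro ⟨hd, -⟩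
      exact hd.2.1 rfl
    · have := H _ _ he'
      rintro ⟨-, hx⟩
      simp only [btw_of_lt hpq] at hx
      rcases hx with hx | hx <;> grind
    · have := H _ _ he
      rintro ⟨hd, hx⟩
      rcases lt_or_gt_of_ne hd.1 with hl | hl
      · simp only [btw_of_lt hl] at hx
        rcases hx with hx | hx <;> grind
      · simp only [btw_of_gt hl] at hx
        rcases hx with hx | hx <;> grind
    · exact h6 _ he _ he'
  · rintro e (rfl | he) e' (rfl | he') ho
    · simp only at ho; grind
    · have := H _ _ he'
      rintro ⟨hx, hy⟩
      simp only [btw_of_lt hpq] at hx hy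
      grind
    · have := H _ _ he
      rintro ⟨hx, hy⟩
      rcases ho with ho | ho
      · simp only at ho; grind
      · simp only [btw_of_gt ho.1] at hx
        grind
    · exact h7 _ he _ he' ho

theorem step {R B : Set ℝ} (hR : R.Finite) (hB : B.Finite) (hRB : Disjoint R B)
    {q r₀ : ℝ} (hq : q ∈ B) (hqm : ∀ b ∈ B, q ≤ b) (hr₀ : r₀ ∈ R) (hlt : r₀ < q)
    (ih : ∀ p ∈ R, ∃! M, ValidM (R \ {p}) (B \ {q}) M) : ∃! M, ValidM R B M := by
  obtain ⟨p, ⟨hp, hpq⟩, hmax⟩ := Set.exists_max_image {r ∈ R | r < q} id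
    (hR.subset (fun x hx => hx.1)) ⟨r₀, hr₀, hlt⟩
  have hpq : p < q := hpq
  have hRR : ∀ r ∈ R, r ≤ p ∨ q < r := by
    intro r hr
    rcases lt_trichotomy r q with h | h | h
    · exact Or.inl (hmax r ⟨hr, h⟩)
    · exact absurd ⟨hr, h ▸ hq⟩ (fun hh : r ∈ R ∧ r ∈ B => hRB.le_bot hh)
    · exact Or.inr h
  obtain ⟨M, hM, hu⟩ := ih p hp
  refine ⟨insert (p, q) M, hM.add hp hq hpq hqm hRR, ?_⟩
  intro N hN
  have hmem := key_mem hN hRB hp hq hpq hqm hRR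
  have := hu _ (hN.remove hmem)
  rw [← this, Set.insert_diff_singleton, Set.insert_eq_of_mem hmem]

theorem exUnique_swap {R B : Set ℝ} (h : ∃! M, ValidM R B M) : ∃! M, ValidM B R M := by
  obtain ⟨M, hM, hu⟩ := h
  refine ⟨_, hM.swap, fun N hN => ?_⟩
  rw [← hu _ hN.swap]
  ext ⟨x, y⟩
  rfl

theorem main_aux (n : ℕ) : ∀ (R B : Set ℝ), R.Finite → B.Finite → Disjoint R B →
    R.ncard = n → B.ncard = n → ∃! M, ValidM R B M := by
  induction n with
  | zero =>
    intro R B hR hB _ hr hb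
    rw [Set.ncard_eq_zero hR] at hr
    rw [Set.ncard_eq_zero hB] at hb
    subst hr hb
    refine ⟨∅, ⟨⟨?_, ?_, ?_⟩, ⟨?_, ?_⟩, ?_, ?_⟩, ?_⟩
    · simp
    · simp
    · simp
    · simp
    · simp
    · simp
    · simp
    · intro N hN
      exact Set.eq_empty_of_forall_notMem fun e he => (hN.1.1 e he).1
  | succ n ih =>
    intro R B hR hB hRB hr hb
    have IH : ∀ p ∈ R, ∀ q ∈ B, ∃! M, ValidM (R \ {p}) (B \ {q}) M := by
      intro p hp q hq
      refine ih _ _ hR.diff hB.diff (hRB.mono Set.diff_subset Set.diff_subset) ?_ ?_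
      · rw [Set.ncard_diff_singleton_of_mem hp, hr]; rfl
      · rw [Set.ncard_diff_singleton_of_mem hq, hb]; rfl
    have neR : R.Nonempty := Set.nonempty_of_ncard_ne_zero (by omega)
    have neB : B.Nonempty := Set.nonempty_of_ncard_ne_zero (by omega)
    obtain ⟨r, hrR, hrm⟩ := Set.exists_min_image R id hR neR
    obtain ⟨b, hbB, hbm⟩ := Set.exists_min_image B id hB neB
    rcases lt_trichotomy r b with h | h | h
    · exact step hR hB hRB hbB hbm hrR h (fun p hp => IH p hp b hbB)
    · exact absurd ⟨hrR, h ▸ hbB⟩ (fun hh : r ∈ R ∧ r ∈ B => hRB.le_bot hh)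
    · exact exUnique_swap (step hB hR hRB.symm hrR hrm hbB h
        (fun p hp => exUnique_swap (IH r hrR p hp)))

/-- For disjoint finite subsets of `ℝ` of equal cardinality there is exactly one
perfect 2-colour matching with no two edges entwined and no two edges of opposite
orientations straddling one another. -/
theorem stmt_19 (R B : Set ℝ) (hR : R.Finite) (hB : B.Finite) (hRB : Disjoint R B)
    (hcard : R.ncard = B.ncard) :
    ∃! M : Set (ℝ × ℝ), IsMatch2 R B M ∧ Perfect2 R B M ∧
      (∀ e ∈ M, ∀ e' ∈ M, ¬ EntwinedP e.1 e.2 e'.1 e'.2) ∧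
      (∀ e ∈ M, ∀ e' ∈ M,
        ((e.1 < e.2 ∧ e'.2 < e'.1) ∨ (e.2 < e.1 ∧ e'.1 < e'.2)) →
        ¬ StraddleP e.1 e.2 e'.1 e'.2) := by
  exact main_aux _ R B hR hB hRB hcard rfl
end
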